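/- arXiv:2012.03650 — 5 statements merged into one kernel-verified Lean document; each statement's English description precedes it below -/
import Mathlib

section
/- Let A be a C*-algebra, let B be a hereditary subalgebra of A, let S be a subset of B, and let I be the closed two-sided ideal of A generated by S. Then I ∩ B is the closed two-sided ideal of B generated by S. -/
/-- A subset `I ⊆ B` is a closed two-sided ideal of `B` (with `B` viewed as an algebra,
here encoded as a subset of an ambient algebra `A`): it is norm closed, an additive
subgroup, and absorbs multiplication by elements of `B`. -/
def IsClosedTwoSidedIdealIn {A : Type*} [NonUnitalRing A] [TopologicalSpace A]
    (B I : Set A) : Prop :=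
  I ⊆ B ∧ IsClosed I ∧ (0 : A) ∈ I ∧ (∀ x ∈ I, ∀ y ∈ I, x + y ∈ I) ∧
    (∀ x ∈ I, -x ∈ I) ∧ ∀ b ∈ B, ∀ x ∈ I, b * x ∈ I ∧ x * b ∈ I

/-- The closed two-sided ideal of `B` generated by `S`: the smallest closed two-sided
ideal of `B` containing `S`. -/
def closedIdealGenIn {A : Type*} [NonUnitalRing A] [TopologicalSpace A]
    (B S : Set A) : Set A :=
  ⋂₀ {I : Set A | IsClosedTwoSidedIdealIn B I ∧ S ⊆ I}

open Filter Topology in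
theorem aux_unit {A : Type*} [NonUnitalCStarAlgebra A]
    (B : NonUnitalStarSubalgebra ℂ A) (hBclosed : IsClosed (B : Set A)) :
    ∃ l : Filter A, l.NeBot ∧ (∀ᶠ e in l, e ∈ B ∧ star e = e) ∧
      (∀ x ∈ B, Tendsto (fun e => e * x) l (𝓝 x)) ∧
      (∀ x ∈ B, Tendsto (fun e => x * e) l (𝓝 x)) := by
  have := hBclosed
  let : PartialOrder B := CStarAlgebra.spectralOrder B
  have : StarOrderedRing B := CStarAlgebra.spectralOrderedRing B
  have h := CStarAlgebra.increasingApproximateUnit B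
  refine ⟨(CStarAlgebra.approximateUnit B).map Subtype.val, inferInstance, ?_, ?_, ?_⟩
  · rw [eventually_map]
    filter_upwards [h.eventually_star_eq] with e he
    exact ⟨e.2, congrArg Subtype.val he⟩
  · intro x hx
    rw [tendsto_map'_iff]
    exact (continuous_subtype_val.tendsto _).comp (h.tendsto_mul_right ⟨x, hx⟩)
  · intro x hx
    rw [tendsto_map'_iff]
    exact (continuous_subtype_val.tendsto _).comp (h.tendsto_mul_left ⟨x, hx⟩)

open Filter Topology in
theorem aux_bab {A : Type*} [NonUnitalCStarAlgebra A] [PartialOrder A] [StarOrderedRing A]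
    (B : NonUnitalStarSubalgebra ℂ A) (hBclosed : IsClosed (B : Set A))
    (hBhered : ∀ a b : A, b ∈ B → 0 ≤ a → a ≤ b → a ∈ B)
    (b : A) (hb : b ∈ B) (a : A) (c : A) (hc : c ∈ B) : b * a * c ∈ B := by
  have key : ∀ e ∈ B, star e = e → ∀ a : A, e * a * e ∈ B := by
    intro e he hs a
    have ha : a ∈ Submodule.span ℂ {a : A | 0 ≤ a} := by
      rw [CStarAlgebra.span_nonneg]; trivial
    induction ha using Submodule.span_induction with
    | mem x hx =>
      have hx : 0 ≤ x := hx
      have h1 := CStarAlgebra.star_left_conjugate_le_norm_smul (a := e)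
        (IsSelfAdjoint.of_nonneg hx)
      have h2 := star_left_conjugate_nonneg hx e
      rw [hs] at h1 h2
      refine hBhered _ _ ?_ h2 h1
      have h3 := SMulMemClass.smul_mem ((‖x‖ : ℝ) : ℂ) (mul_mem he he)
      simpa using h3
    | zero => simp
    | add x y _ _ hx hy => rw [mul_add, add_mul]; exact add_mem hx hy
    | smul r x _ hx => rw [mul_smul_comm, smul_mul_assoc]; exact SMulMemClass.smul_mem r hx
  obtain ⟨l, hl, hev, hL, hR⟩ := aux_unit B hBclosed
  have ht : Tendsto (fun e => (b * e) * a * (e * c)) l (𝓝 (b * a * c)) :=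
    ((hR b hb).mul_const a).mul (hL c hc)
  refine hBclosed.mem_of_tendsto ht ?_
  filter_upwards [hev] with e he
  have := mul_mem (mul_mem hb (key e he.1 he.2 a)) hc
  simpa [mul_assoc] using this

/-- If `B` is a hereditary subalgebra of a C*-algebra `A`, `S ⊆ B`, and
`I` is the closed two-sided ideal of `A` generated by `S`, then `I ∩ B` is the closed
two-sided ideal of `B` generated by `S`. -/
theorem stmt0 {A : Type*} [NonUnitalCStarAlgebra A] [PartialOrder A] [StarOrderedRing A]
    (B : NonUnitalStarSubalgebra ℂ A) (hBclosed : IsClosed (B : Set A))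
    (hBhered : ∀ a b : A, b ∈ B → 0 ≤ a → a ≤ b → a ∈ B)
    (S : Set A) (hS : S ⊆ (B : Set A))
    (I : Set A) (hI : I = closedIdealGenIn Set.univ S) :
    I ∩ (B : Set A) = closedIdealGenIn (B : Set A) S := by
  obtain ⟨l, hl, hev, hL, hR⟩ := aux_unit B hBclosed
  have bab := aux_bab B hBclosed hBhered
  subst hI
  apply Set.Subset.antisymm
  · rintro x ⟨hxI, hxB⟩ J ⟨⟨hJB, hJc, hJ0, hJa, hJn, hJm⟩, hSJ⟩
    have hK : x ∈ {x : A | ∀ b ∈ B, ∀ c ∈ B, ∀ u v : A, b * u * x * (v * c) ∈ J} := by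
      refine hxI _ ⟨⟨Set.subset_univ _, ?_, ?_, ?_, ?_, ?_⟩, ?_⟩
      · simp only [Set.ofPred_forall]
        refine isClosed_iInter fun b => isClosed_iInter fun _ => isClosed_iInter fun c =>
          isClosed_iInter fun _ => isClosed_iInter fun u => isClosed_iInter fun v => ?_
        exact hJc.preimage (f := fun x => b * u * x * (v * c)) (by fun_prop)
      · intro b _ c _ u v
        simpa using hJ0
      · intro x hx y hy b hb c hc u v
        rw [mul_add, add_mul]
        exact hJa _ (hx b hb c hc u v) _ (hy b hb c hc u v)
      · intro x hx b hb c hc u v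
        rw [mul_neg, neg_mul]
        exact hJn _ (hx b hb c hc u v)
      · intro a _ x hx
        refine ⟨fun b hb c hc u v => ?_, fun b hb c hc u v => ?_⟩
        · simpa [mul_assoc] using hx b hb c hc (u * a) v
        · simpa [mul_assoc] using hx b hb c hc u (a * v)
      · intro s hs b hb c hc u v
        have ht : Filter.Tendsto (fun e => b * u * (e * s) * (v * c)) l
            (nhds (b * u * s * (v * c))) :=
          ((hL s (hS hs)).const_mul (b * u)).mul_const (v * c)
        refine hJc.mem_of_tendsto ht ?_
        filter_upwards [hev] with e he
        have ht' : Filter.Tendsto (fun f => b * u * (e * (s * f)) * (v * c)) l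
            (nhds (b * u * (e * s) * (v * c))) :=
          (((hR s (hS hs)).const_mul e).const_mul (b * u)).mul_const (v * c)
        refine hJc.mem_of_tendsto ht' ?_
        filter_upwards [hev] with f hf
        have h1 := (hJm _ (bab b hb u e he.1) s (hSJ hs)).1
        have h2 := (hJm _ (bab f hf.1 v c hc) _ h1).2
        simpa [mul_assoc] using h2
    have step : ∀ b ∈ B, ∀ c ∈ B, b * x * c ∈ J := by
      intro b hb c hc
      have ht : Filter.Tendsto (fun e => (b * e) * x * (e * c)) l (nhds (b * x * c)) :=
        ((hR b hb).mul_const x).mul (hL c hc)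
      refine hJc.mem_of_tendsto ht ?_
      exact Filter.Eventually.of_forall fun e => hK b hb c hc e e
    have step2 : ∀ b ∈ B, b * x ∈ J := by
      intro b hb
      refine hJc.mem_of_tendsto (hR (b * x) (mul_mem hb hxB)) ?_
      filter_upwards [hev] with e he using step b hb e he.1
    refine hJc.mem_of_tendsto (hL x hxB) ?_
    filter_upwards [hev] with e he using step2 e he.1
  · intro x hx
    refine hx _ ⟨⟨Set.inter_subset_right, ?_, ?_, ?_, ?_, ?_⟩, ?_⟩
    · exact (isClosed_sInter fun J hJ => hJ.1.2.1).inter hBclosed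
    · exact ⟨fun J hJ => hJ.1.2.2.1, zero_mem B⟩
    · exact fun x hx y hy => ⟨fun J hJ => hJ.1.2.2.2.1 x (hx.1 J hJ) y (hy.1 J hJ),
        add_mem hx.2 hy.2⟩
    · exact fun x hx => ⟨fun J hJ => hJ.1.2.2.2.2.1 x (hx.1 J hJ), neg_mem hx.2⟩
    · exact fun b hb x hx =>
        ⟨⟨fun J hJ => (hJ.1.2.2.2.2.2 b trivial x (hx.1 J hJ)).1, mul_mem hb hx.2⟩,
         ⟨fun J hJ => (hJ.1.2.2.2.2.2 b trivial x (hx.1 J hJ)).2, mul_mem hx.2 hb⟩⟩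
    · exact fun s hs => ⟨fun J hJ => hJ.2 hs, hS hs⟩
end

section
/- Let A be a C*-algebra, let J be a closed two-sided ideal of A, let h ∈ J be a positive contraction, and let π : A → B be a surjective *-homomorphism of C*-algebras with kernel J. Then: (i) the intersection of the closure of (1−h)A(1−h) with J equals the closure of (1−h)J(1−h); and (ii) π maps the closure of (1−h)A(1−h) onto B. Consequently, the restriction of π to the subalgebra closure((1−h)A(1−h)) is surjective onto B with kernel closure((1−h)J(1−h)). -/
open Filter Topology

noncomputable def cesV {E : Type*} [NormedAddCommGroup E] [NormedSpace ℂ E] (H : E →L[ℂ] E)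
    (n : ℕ) : E →L[ℂ] E :=
  ((n : ℂ) + 1)⁻¹ • ∑ i ∈ Finset.range (n + 1), ∑ j ∈ Finset.range i, H ^ j

theorem cesV_mul {E : Type*} [NormedAddCommGroup E] [NormedSpace ℂ E] (H : E →L[ℂ] E) (n : ℕ) :
    (1 - H) * cesV H n = 1 - ((n : ℂ) + 1)⁻¹ • ∑ i ∈ Finset.range (n + 1), H ^ i := by
  have hn : ((n : ℂ) + 1) ≠ 0 := by exact_mod_cast Nat.succ_ne_zero n
  unfold cesV
  rw [mul_smul_comm, Finset.mul_sum]
  simp_rw [mul_neg_geom_sum]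
  rw [Finset.sum_sub_distrib, smul_sub]
  congr 1
  rw [Finset.sum_const, Finset.card_range, ← Nat.cast_smul_eq_nsmul ℂ, smul_smul]
  push_cast
  rw [inv_mul_cancel₀ hn, one_smul]

theorem cesV_commute {E : Type*} [NormedAddCommGroup E] [NormedSpace ℂ E] (H K : E →L[ℂ] E)
    (hc : Commute K H) (n : ℕ) : Commute K (cesV H n) := by
  unfold cesV
  refine Commute.smul_right ?_ _
  exact Commute.sum_right _ _ _ fun i _ => Commute.sum_right _ _ _ fun j _ => hc.pow_right j

theorem cesV_mem {E : Type*} [NormedAddCommGroup E] [NormedSpace ℂ E] (H : E →L[ℂ] E)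
    (S : Submodule ℂ E) (hS : ∀ x ∈ S, H x ∈ S) (n : ℕ) (x : E) (hx : x ∈ S) :
    cesV H n x ∈ S := by
  have hp : ∀ j : ℕ, (H ^ j) x ∈ S := by
    intro j
    induction j with
    | zero => simpa using hx
    | succ k ih => rw [pow_succ']; exact hS _ ih
  unfold cesV
  rw [ContinuousLinearMap.smul_apply, ContinuousLinearMap.sum_apply]
  refine S.smul_mem _ (S.sum_mem fun i _ => ?_)
  rw [ContinuousLinearMap.sum_apply]
  exact S.sum_mem fun j _ => hp j

theorem pow_bd {E : Type*} [NormedAddCommGroup E] [NormedSpace ℂ E] (H : E →L[ℂ] E)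
    (hH : ∀ x, ‖H x‖ ≤ ‖x‖) (j : ℕ) (x : E) : ‖(H ^ j) x‖ ≤ ‖x‖ := by
  induction j with
  | zero => simp
  | succ k ih => rw [pow_succ']; exact (hH _).trans ih

theorem cesV_bd {E : Type*} [NormedAddCommGroup E] [NormedSpace ℂ E] (H : E →L[ℂ] E)
    (hH : ∀ x, ‖H x‖ ≤ ‖x‖) (n : ℕ) (x : E) : ‖((1 - H) * cesV H n) x‖ ≤ 2 * ‖x‖ := by
  rw [cesV_mul, ContinuousLinearMap.sub_apply, ContinuousLinearMap.smul_apply,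
    ContinuousLinearMap.sum_apply]
  have hnn : ‖((n : ℂ) + 1)⁻¹‖ = ((n : ℝ) + 1)⁻¹ := by
    rw [norm_inv]; congr 1; exact_mod_cast Complex.norm_natCast (n + 1)
  have h1 : ‖((n : ℂ) + 1)⁻¹ • ∑ i ∈ Finset.range (n + 1), (H ^ i) x‖ ≤ ‖x‖ := by
    rw [norm_smul, hnn, inv_mul_le_iff₀ (by positivity)]
    refine (norm_sum_le _ _).trans ?_
    refine (Finset.sum_le_sum fun i _ => pow_bd H hH i x).trans ?_
    simp
  refine (norm_sub_le _ _).trans ?_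
  have : ‖(1 : E →L[ℂ] E) x‖ = ‖x‖ := by simp
  linarith

theorem cesV_tendsto {E : Type*} [NormedAddCommGroup E] [NormedSpace ℂ E] (H : E →L[ℂ] E)
    (hH : ∀ x, ‖H x‖ ≤ ‖x‖) (x : E) (hx : x ∈ closure (Set.range (1 - H : E →L[ℂ] E))) :
    Tendsto (fun n => ((1 - H) * cesV H n) x) atTop (𝓝 x) := by
  rw [Metric.tendsto_atTop]
  intro ε hε
  obtain ⟨_, ⟨a, rfl⟩, hy⟩ := Metric.mem_closure_iff.1 hx (ε / 6) (by positivity)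
  obtain ⟨N, hN⟩ := exists_nat_gt (2 * ‖a‖ / (ε / 6))
  refine ⟨N, fun n hn => ?_⟩
  set y := (1 - H : E →L[ℂ] E) a with hyd
  have hnn : ‖((n : ℂ) + 1)⁻¹‖ = ((n : ℝ) + 1)⁻¹ := by
    rw [norm_inv]; congr 1; exact_mod_cast Complex.norm_natCast (n + 1)
  have e1 : ((1 - H) * cesV H n) y - y = -(((n : ℂ) + 1)⁻¹ • (a - (H ^ (n + 1)) a)) := by
    have : (1 - H) * cesV H n * (1 - H) - (1 - H)
        = -(((n : ℂ) + 1)⁻¹ • (1 - H ^ (n + 1))) := by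
      rw [cesV_mul, sub_mul, one_mul, smul_mul_assoc, geom_sum_mul_neg]
      abel
    simpa [hyd] using congrArg (fun T : E →L[ℂ] E => T a) this
  have e2 : ‖((1 - H) * cesV H n) y - y‖ < ε / 6 := by
    rw [e1, norm_neg, norm_smul, hnn, inv_mul_lt_iff₀ (by positivity)]
    have h1 := norm_sub_le a ((H ^ (n + 1)) a)
    have h2 := pow_bd H hH (n + 1) a
    rw [div_lt_iff₀ (by positivity)] at hN
    have h3 : (N : ℝ) ≤ n := by exact_mod_cast hn
    nlinarith
  have e3 := cesV_bd H hH n (x - y)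
  rw [dist_eq_norm] at hy ⊢
  have e4 : ((1 - H) * cesV H n) x - x
      = ((1 - H) * cesV H n) (x - y) + (((1 - H) * cesV H n) y - y) - (x - y) := by
    rw [map_sub]; abel
  rw [e4]
  have e5 := norm_sub_le (((1 - H) * cesV H n) (x - y) + (((1 - H) * cesV H n) y - y)) (x - y)
  have e6 := norm_add_le (((1 - H) * cesV H n) (x - y)) (((1 - H) * cesV H n) y - y)
  linarith

theorem main_closure {E : Type*} [NormedAddCommGroup E] [NormedSpace ℂ E] (H K : E →L[ℂ] E)
    (hH : ∀ x, ‖H x‖ ≤ ‖x‖) (hK : ∀ x, ‖K x‖ ≤ ‖x‖) (hc : Commute H K)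
    (S : Submodule ℂ E) (hSH : ∀ x ∈ S, H x ∈ S) (hSK : ∀ x ∈ S, K x ∈ S) (x : E) (hxS : x ∈ S)
    (hx : x ∈ closure (Set.range ((1 - H) * (1 - K) : E →L[ℂ] E))) :
    x ∈ closure (((1 - H) * (1 - K) : E →L[ℂ] E) '' (S : Set E)) := by
  have hc' : Commute (1 - H) (1 - K) :=
    ((Commute.one_left _).sub_left ((Commute.one_right _).sub_right hc))
  have hxH : x ∈ closure (Set.range (1 - H : E →L[ℂ] E)) := by
    refine closure_mono ?_ hx
    rintro _ ⟨a, rfl⟩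
    exact ⟨(1 - K : E →L[ℂ] E) a, rfl⟩
  have hxK : x ∈ closure (Set.range (1 - K : E →L[ℂ] E)) := by
    refine closure_mono ?_ hx
    rintro _ ⟨a, rfl⟩
    rw [hc'.eq]
    exact ⟨(1 - H : E →L[ℂ] E) a, rfl⟩
  have t1 := cesV_tendsto H hH x hxH
  have t2 := cesV_tendsto K hK x hxK
  have t3 : Tendsto (fun n => ((1 - H) * cesV H n) (((1 - K) * cesV K n) x - x)) atTop (𝓝 0) := by
    refine squeeze_zero_norm (fun n => cesV_bd H hH n _) ?_
    have := ((t2.sub_const x).norm).const_mul 2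
    simpa using this
  have t4 : Tendsto (fun n => ((1 - H) * cesV H n) (((1 - K) * cesV K n) x)) atTop (𝓝 x) := by
    have := t3.add t1
    simpa only [map_sub, sub_add_cancel, zero_add] using this
  refine mem_closure_of_tendsto t4 (Eventually.of_forall fun n => ?_)
  refine ⟨cesV H n (cesV K n x), cesV_mem H S hSH n _ (cesV_mem K S hSK n x hxS), ?_⟩
  have hcc : Commute (1 - K) (cesV H n) :=
    cesV_commute H (1 - K) ((Commute.one_left _).sub_left hc.symm) n
  have : (1 - H) * (1 - K) * (cesV H n * cesV K n)
      = (1 - H) * cesV H n * ((1 - K) * cesV K n) := by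
    rw [mul_assoc, ← mul_assoc (1 - K), hcc.eq]; simp only [mul_assoc]
  exact congrArg (fun T : E →L[ℂ] E => T x) this

/-- A subset `I` is a closed two-sided ideal of the algebra `A`: it is norm closed, an
additive subgroup, and absorbs multiplication by elements of `A`. -/
def IsClosedTwoSidedIdeal {A : Type*} [NonUnitalRing A] [TopologicalSpace A]
    (I : Set A) : Prop :=
  IsClosed I ∧ (0 : A) ∈ I ∧ (∀ x ∈ I, ∀ y ∈ I, x + y ∈ I) ∧
    (∀ x ∈ I, -x ∈ I) ∧ ∀ a : A, ∀ x ∈ I, a * x ∈ I ∧ x * a ∈ I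

/-- Let `J` be a closed two-sided ideal of a C*-algebra `A`, let `h ∈ J`
be a positive contraction, and let `π : A → B` be a surjective *-homomorphism with kernel
`J`.  (Here `(1-h)a(1-h)`, computed in the minimal unitization, is `a - h*a - a*h + h*a*h`.)
Then:
(i)  `closure((1-h)A(1-h)) ∩ J = closure((1-h)J(1-h))`;
(ii) `π` maps `closure((1-h)A(1-h))` onto `B`;
and consequently the restriction of `π` to `closure((1-h)A(1-h))` is surjective onto `B`
with kernel `closure((1-h)J(1-h))`. -/
theorem stmt2 {A B : Type*} [NonUnitalCStarAlgebra A] [NonUnitalCStarAlgebra B]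
    [PartialOrder A] [StarOrderedRing A]
    (J : Set A) (hJ : IsClosedTwoSidedIdeal J)
    (h : A) (hhJ : h ∈ J) (hpos : 0 ≤ h) (hcontr : ‖h‖ ≤ 1)
    (π : A →⋆ₙₐ[ℂ] B) (hsurj : Function.Surjective π)
    (hker : ∀ x : A, π x = 0 ↔ x ∈ J) :
    (closure {x : A | ∃ a : A, x = a - h * a - a * h + h * a * h} ∩ J
      = closure {x : A | ∃ a ∈ J, x = a - h * a - a * h + h * a * h}) ∧
    (π '' closure {x : A | ∃ a : A, x = a - h * a - a * h + h * a * h} = Set.univ) ∧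
    (∀ x ∈ closure {x : A | ∃ a : A, x = a - h * a - a * h + h * a * h},
      π x = 0 ↔ x ∈ closure {x : A | ∃ a ∈ J, x = a - h * a - a * h + h * a * h}) := by
  obtain ⟨hcl, h0, hadd, hneg, hmul⟩ := hJ
  have hπh : π h = 0 := (hker h).2 hhJ
  have hπ : ∀ a : A, π (a - h * a - a * h + h * a * h) = π a := by
    intro a; simp [hπh]
  let S : Submodule ℂ A :=
    { carrier := J
      zero_mem' := h0
      add_mem' := fun {a b} ha hb => hadd a ha b hb
      smul_mem' := fun c x hx => (hker _).1 (by rw [map_smul, (hker x).2 hx, smul_zero]) }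
  let H : A →L[ℂ] A := ContinuousLinearMap.mul ℂ A h
  let K : A →L[ℂ] A := (ContinuousLinearMap.mul ℂ A).flip h
  have hH : ∀ x, ‖H x‖ ≤ ‖x‖ := fun x =>
    (norm_mul_le h x).trans (mul_le_of_le_one_left (norm_nonneg _) hcontr)
  have hK : ∀ x, ‖K x‖ ≤ ‖x‖ := fun x =>
    (norm_mul_le x h).trans (mul_le_of_le_one_right (norm_nonneg _) hcontr)
  have hc : Commute H K := by
    ext x
    exact (mul_assoc h x h).symm
  have hT : ∀ a, ((1 - H) * (1 - K) : A →L[ℂ] A) a = a - h * a - a * h + h * a * h := by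
    intro a
    change (a - a * h) - h * (a - a * h) = _
    rw [mul_sub, mul_assoc]; abel
  have e1 : {x : A | ∃ a : A, x = a - h * a - a * h + h * a * h}
      = Set.range ((1 - H) * (1 - K) : A →L[ℂ] A) := by
    ext x; simp only [Set.mem_setOf_eq, Set.mem_range, hT, eq_comm]
  have e2 : {x : A | ∃ a ∈ J, x = a - h * a - a * h + h * a * h}
      = ((1 - H) * (1 - K) : A →L[ℂ] A) '' (S : Set A) := by
    ext x
    simp only [Set.mem_setOf_eq, Set.mem_image, hT]
    exact ⟨fun ⟨a, ha, hx⟩ => ⟨a, ha, hx.symm⟩, fun ⟨a, ha, hx⟩ => ⟨a, ha, hx.symm⟩⟩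
  have key : closure {x : A | ∃ a : A, x = a - h * a - a * h + h * a * h} ∩ J
      = closure {x : A | ∃ a ∈ J, x = a - h * a - a * h + h * a * h} := by
    apply Set.Subset.antisymm
    · rintro x ⟨hx, hxJ⟩
      rw [e1] at hx
      rw [e2]
      exact main_closure H K hH hK hc S (fun x hx => (hmul h x hx).1)
        (fun x hx => (hmul h x hx).2) x hxJ hx
    · refine Set.subset_inter (closure_mono ?_) (closure_minimal ?_ hcl)
      · rintro x ⟨a, _, rfl⟩
        exact ⟨a, rfl⟩
      · rintro x ⟨a, ha, rfl⟩
        exact (hker _).1 ((hπ a).trans ((hker a).2 ha))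
  refine ⟨key, ?_, ?_⟩
  · rw [Set.eq_univ_iff_forall]
    intro b
    obtain ⟨a, rfl⟩ := hsurj b
    exact ⟨_, subset_closure ⟨a, rfl⟩, hπ a⟩
  · intro x hx
    rw [← key, hker]
    exact ⟨fun hj => ⟨hx, hj⟩, fun hj => hj.2⟩
end

section
/- Let A be a C*-algebra, let J be a closed two-sided ideal of A, and let h ∈ J be a positive contraction. If a ∈ closure((1−h)A(1−h)) satisfies a(1−h) ∈ J, then a ∈ closure((1−h)J(1−h)). Equivalently, if a lies in closure((1−h)A(1−h)) but not in closure((1−h)J(1−h)), then a(1−h) ∈ A \ J. -/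
lemma aux_real (t : ℝ) (h0 : 0 ≤ t) (h1 : t ≤ 1) (n : ℕ) :
    ‖t ^ (n+1) - t ^ (n+2)‖ ≤ 1 / ((n : ℝ) + 1) := by
  have key : ∀ n : ℕ, ((n : ℝ) + 1) * (t ^ n * (1 - t)) ≤ 1 - t ^ (n+1) := by
    intro n
    induction n with
    | zero => simp
    | succ k ih =>
      have e1 : 0 ≤ t ^ k * (1 - t) := mul_nonneg (pow_nonneg h0 _) (by linarith)
      have e2 : t ^ (k+1) * (1 - t) ≤ t ^ k * (1 - t) := by
        rw [pow_succ]; nlinarith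
      have e3 : ((k : ℝ) + 1) * (t ^ (k+1) * (1 - t)) ≤ ((k : ℝ) + 1) * (t ^ k * (1 - t)) :=
        mul_le_mul_of_nonneg_left e2 (by positivity)
      push_cast
      have e4 : t ^ (k+1+1) = t ^ (k+1) * t := pow_succ _ _
      rw [e4]
      linarith
  have e0 : 0 ≤ t ^ n * (1 - t) := mul_nonneg (pow_nonneg h0 _) (by linarith)
  have e : t ^ (n+1) - t ^ (n+2) = t * (t ^ n * (1 - t)) := by ring
  rw [e, Real.norm_of_nonneg (mul_nonneg h0 e0), le_div_iff₀ (by positivity)]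
  have := key n
  have := pow_nonneg h0 (n+1)
  nlinarith

section aux
variable {A : Type*} [NonUnitalCStarAlgebra A] [PartialOrder A] [StarOrderedRing A]

lemma aux_cfc (h : A) (hpos : 0 ≤ h) (hcontr : ‖h‖ ≤ 1) (n : ℕ) :
    ‖cfcₙ (fun t : ℝ => t ^ (n+1) - t ^ (n+2)) h‖ ≤ 1 / ((n : ℝ) + 1) := by
  apply norm_cfcₙ_le
  intro t ht
  have h0 : 0 ≤ t := quasispectrum_nonneg_of_nonneg h hpos t ht
  have h1 : ‖t‖ ≤ ‖h‖ :=
    NonUnitalIsometricContinuousFunctionalCalculus.norm_quasispectrum_le h ht hpos.isSelfAdjoint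
  rw [Real.norm_of_nonneg h0] at h1
  exact aux_real t h0 (h1.trans hcontr) n

lemma aux_pow (h : A) (hpos : 0 ≤ h) (n : ℕ) :
    cfcₙ (fun t : ℝ => t ^ (n+2)) h = h * cfcₙ (fun t : ℝ => t ^ (n+1)) h ∧
    cfcₙ (fun t : ℝ => t ^ (n+2)) h = cfcₙ (fun t : ℝ => t ^ (n+1)) h * h := by
  have hs : IsSelfAdjoint h := hpos.isSelfAdjoint
  have hid : cfcₙ (fun t : ℝ => t) h = h := cfcₙ_id' ℝ h
  have e1 := cfcₙ_mul (fun t : ℝ => t) (fun t : ℝ => t ^ (n+1)) h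
    (by fun_prop) (by simp) (by fun_prop) (by simp)
  have e2 := cfcₙ_mul (fun t : ℝ => t ^ (n+1)) (fun t : ℝ => t) h
    (by fun_prop) (by simp) (by fun_prop) (by simp)
  rw [hid] at e1 e2
  rw [← e1, ← e2]
  constructor <;> congr 1 <;> funext t <;> ring

lemma aux_tend (h : A) (hpos : 0 ≤ h) (hcontr : ‖h‖ ≤ 1) :
    Filter.Tendsto (fun n : ℕ => cfcₙ (fun t : ℝ => t ^ (n+1)) h -
      cfcₙ (fun t : ℝ => t ^ (n+2)) h) Filter.atTop (nhds 0) := by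
  refine squeeze_zero_norm (fun n => ?_) tendsto_one_div_add_atTop_nhds_zero_nat
  rw [← cfcₙ_sub (fun t : ℝ => t ^ (n+1)) (fun t : ℝ => t ^ (n+2)) h
    (by fun_prop) (by simp) (by fun_prop) (by simp)]
  exact aux_cfc h hpos hcontr n

lemma aux_one (h : A) (hpos : 0 ≤ h) (hcontr : ‖h‖ ≤ 1) (n : ℕ) :
    ‖cfcₙ (fun t : ℝ => t ^ (n+1)) h‖ ≤ 1 := by
  apply norm_cfcₙ_le
  intro t ht
  have h1 : ‖t‖ ≤ ‖h‖ :=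
    NonUnitalIsometricContinuousFunctionalCalculus.norm_quasispectrum_le h ht hpos.isSelfAdjoint
  rw [norm_pow]
  exact pow_le_one₀ (norm_nonneg _) (h1.trans hcontr)

lemma aux_geom (h : A) (hpos : 0 ≤ h) (J : Set A) (hJ : IsClosedTwoSidedIdeal J) (n : ℕ)
    (a : A) (ha : a ∈ J) :
    (∃ c ∈ J, c - h * c = a - cfcₙ (fun t : ℝ => t ^ (n+1)) h * a) ∧
    (∃ c ∈ J, c - c * h = a - a * cfcₙ (fun t : ℝ => t ^ (n+1)) h) := by
  have hs : IsSelfAdjoint h := hpos.isSelfAdjoint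
  have hid : cfcₙ (fun t : ℝ => t) h = h := cfcₙ_id' ℝ h
  obtain ⟨-, -, hadd, -, hmul⟩ := hJ
  induction n with
  | zero => exact ⟨⟨a, ha, by simp [hid]⟩, ⟨a, ha, by simp [hid]⟩⟩
  | succ k ih =>
    obtain ⟨⟨c, hc, ec⟩, ⟨d, hd, ed⟩⟩ := ih
    refine ⟨⟨c + cfcₙ (fun t : ℝ => t ^ (k+1)) h * a, hadd _ hc _ (hmul _ _ ha).1, ?_⟩,
      ⟨d + a * cfcₙ (fun t : ℝ => t ^ (k+1)) h, hadd _ hd _ (hmul _ _ ha).2, ?_⟩⟩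
    · rw [(aux_pow h hpos k).1, mul_add, mul_assoc, add_sub_add_comm, ec]; abel
    · rw [(aux_pow h hpos k).2, add_mul, ← mul_assoc, add_sub_add_comm, ed]; abel

end aux

/-- Let `J` be a closed two-sided ideal of a C*-algebra `A` and let
`h ∈ J` be a positive contraction.  (Here `(1-h)b(1-h)`, computed in the minimal
unitization, is `b - h*b - b*h + h*b*h`, and `a(1-h) = a - a*h`.)  If an element
`a ∈ closure((1-h)A(1-h))` satisfies `a(1-h) ∈ J`, then `a ∈ closure((1-h)J(1-h))`. -/
theorem stmt3 {A : Type*} [NonUnitalCStarAlgebra A] [PartialOrder A] [StarOrderedRing A]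
    (J : Set A) (hJ : IsClosedTwoSidedIdeal J)
    (h : A) (hhJ : h ∈ J) (hpos : 0 ≤ h) (hcontr : ‖h‖ ≤ 1)
    (a : A) (ha : a ∈ closure {x : A | ∃ b : A, x = b - h * b - b * h + h * b * h})
    (haJ : a - a * h ∈ J) :
    a ∈ closure {x : A | ∃ b ∈ J, x = b - h * b - b * h + h * b * h} := by
  obtain ⟨hcl, h0, hadd, hneg, hmul⟩ := id hJ
  have haJ' : a ∈ J := by
    have := hadd _ haJ _ (hmul a h hhJ).1
    simpa using this
  set p : ℕ → A := fun n => cfcₙ (fun t : ℝ => t ^ (n+1)) h with hp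
  have hp1 : ∀ n, ‖p n‖ ≤ 1 := aux_one h hpos hcontr
  have hpt : Filter.Tendsto (fun n => p n - p (n+1)) Filter.atTop (nhds 0) :=
    aux_tend h hpos hcontr
  have hpl : ∀ n, p (n+1) = h * p n := fun n => (aux_pow h hpos n).1
  have hpr : ∀ n, p (n+1) = p n * h := fun n => (aux_pow h hpos n).2
  have hL : Filter.Tendsto (fun n => p n * a) Filter.atTop (nhds 0) := by
    rw [Metric.tendsto_atTop]
    intro ε hε
    obtain ⟨x, ⟨b, hb⟩, hx⟩ := Metric.mem_closure_iff.1 ha (ε/2) (by positivity)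
    have ht : Filter.Tendsto (fun n => (p n - p (n+1)) * (b - b * h)) Filter.atTop (nhds 0) := by
      simpa using hpt.mul_const (b - b * h)
    obtain ⟨N, hN⟩ := Metric.tendsto_atTop.1 ht (ε/2) (by positivity)
    refine ⟨N, fun n hn => ?_⟩
    have e : p n * a = p n * (a - x) + (p n - p (n+1)) * (b - b * h) := by
      rw [hb, hpr]; noncomm_ring
    have h2 := hN n hn
    rw [dist_zero_right] at h2 ⊢
    rw [dist_eq_norm] at hx
    have h3 : ‖p n * (a - x)‖ ≤ ‖a - x‖ :=
      (norm_mul_le _ _).trans (mul_le_of_le_one_left (norm_nonneg _) (hp1 n))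
    rw [e]
    have := norm_add_le (p n * (a - x)) ((p n - p (n+1)) * (b - b * h))
    linarith
  have hR : Filter.Tendsto (fun n => a * p n) Filter.atTop (nhds 0) := by
    rw [Metric.tendsto_atTop]
    intro ε hε
    obtain ⟨x, ⟨b, hb⟩, hx⟩ := Metric.mem_closure_iff.1 ha (ε/2) (by positivity)
    have ht : Filter.Tendsto (fun n => (b - h * b) * (p n - p (n+1))) Filter.atTop (nhds 0) := by
      simpa using hpt.const_mul (b - h * b)
    obtain ⟨N, hN⟩ := Metric.tendsto_atTop.1 ht (ε/2) (by positivity)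
    refine ⟨N, fun n hn => ?_⟩
    have e : a * p n = (a - x) * p n + (b - h * b) * (p n - p (n+1)) := by
      rw [hb, hpl]; noncomm_ring
    have h2 := hN n hn
    rw [dist_zero_right] at h2 ⊢
    rw [dist_eq_norm] at hx
    have h3 : ‖(a - x) * p n‖ ≤ ‖a - x‖ :=
      (norm_mul_le _ _).trans (mul_le_of_le_one_right (norm_nonneg _) (hp1 n))
    rw [e]
    have := norm_add_le ((a - x) * p n) ((b - h * b) * (p n - p (n+1)))
    linarith
  have hLR : Filter.Tendsto (fun n => p n * a * p n) Filter.atTop (nhds 0) := by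
    refine squeeze_zero_norm (fun n => ?_) (tendsto_zero_iff_norm_tendsto_zero.1 hL)
    exact (norm_mul_le _ _).trans (mul_le_of_le_one_right (norm_nonneg _) (hp1 n))
  have hfin : Filter.Tendsto (fun n => a - p n * a - a * p n + p n * a * p n)
      Filter.atTop (nhds a) := by
    simpa using ((hL.const_sub a).sub hR).add hLR
  refine mem_closure_of_tendsto hfin (Filter.Eventually.of_forall fun n => ?_)
  obtain ⟨c, hc, ec⟩ := (aux_geom h hpos J hJ n a haJ').1
  obtain ⟨d, hd, ed⟩ := (aux_geom h hpos J hJ n c hc).2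
  refine ⟨d, hd, ?_⟩
  change c - h * c = a - p n * a at ec
  change d - d * h = c - c * p n at ed
  calc a - p n * a - a * p n + p n * a * p n
      = (a - p n * a) - (a - p n * a) * p n := by noncomm_ring
    _ = (c - h * c) - (c - h * c) * p n := by rw [ec]
    _ = (c - c * p n) - h * (c - c * p n) := by noncomm_ring
    _ = (d - d * h) - h * (d - d * h) := by rw [ed]
    _ = d - h * d - d * h + h * d * h := by noncomm_ring
end

section
/- Let A be a C*-algebra and let J be a closed two-sided ideal of A. Suppose that for every a ∈ A \ J, the set {a j a* : j ∈ J} is full in J, i.e., the closed two-sided ideal of J generated by {a j a* : j ∈ J} equals J. Then every closed two-sided ideal I of A satisfies either I ⊆ J or J ⊆ I. -/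
/-- Let `J` be a closed two-sided ideal of a C*-algebra `A`.  Suppose
that for every `a ∈ A \ J` the set `{a j a* : j ∈ J}` is full in `J`, i.e. the closed
two-sided ideal of `J` it generates equals `J`.  Then every closed two-sided ideal `I`
of `A` satisfies `I ⊆ J` or `J ⊆ I`. -/
theorem stmt5 {A : Type*} [NonUnitalCStarAlgebra A]
    (J : Set A) (hJ : IsClosedTwoSidedIdealIn Set.univ J)
    (hfull : ∀ a : A, a ∉ J →
      closedIdealGenIn J {x : A | ∃ j ∈ J, x = a * j * star a} = J)
    (I : Set A) (hI : IsClosedTwoSidedIdealIn Set.univ I) :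
    I ⊆ J ∨ J ⊆ I := by
  by_contra hcon
  push Not at hcon
  obtain ⟨h1, h2⟩ := hcon
  obtain ⟨a, haI, haJ⟩ := Set.not_subset.mp h1
  apply h2
  obtain ⟨-, Jc, J0, Ja, Jn, Jm⟩ := hJ
  obtain ⟨-, Ic, I0, Ia, In, Im⟩ := hI
  intro x hx
  rw [← hfull a haJ] at hx
  have key : x ∈ I ∩ J := by
    refine Set.mem_sInter.mp hx (I ∩ J) ⟨⟨Set.inter_subset_right, Ic.inter Jc, ⟨I0, J0⟩, ?_, ?_, ?_⟩, ?_⟩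
    · exact fun x hx y hy => ⟨Ia x hx.1 y hy.1, Ja x hx.2 y hy.2⟩
    · exact fun x hx => ⟨In x hx.1, Jn x hx.2⟩
    · exact fun b _ x hx =>
        ⟨⟨(Im b trivial x hx.1).1, (Jm b trivial x hx.2).1⟩,
          ⟨(Im b trivial x hx.1).2, (Jm b trivial x hx.2).2⟩⟩
    · rintro y ⟨j, hj, rfl⟩
      exact ⟨(Im _ trivial _ (Im j trivial a haI).2).2,
        (Jm _ trivial _ (Jm a trivial j hj).1).2⟩
  exact key.1
end

section
/- Let B and E be C*-algebras. For closed two-sided ideals I_C of C₀((0,1], ℂ) and I_B of B, let I_C ⊙ I_B denote the closed two-sided ideal of C₀((0,1], B) generated by the functions t ↦ g(t)·x with g ∈ I_C and x ∈ I_B. Let T be a map from the set of closed two-sided ideals of B to the set of closed two-sided ideals of E such that for every family (I_λ)_{λ∈Λ} of closed two-sided ideals of B, T applied to the closed two-sided ideal generated by ⋃_λ I_λ equals the closed two-sided ideal generated by ⋃_λ T(I_λ). Suppose Φ : C₀((0,1], B) → E is a *-homomorphism such that for all nonzero closed two-sided ideals I_C of C₀((0,1], ℂ) and I_B of B, the closed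 two-sided ideal of E generated by Φ(I_C ⊙ I_B) equals T(I_B). Then for every f ∈ C₀((0,1], B), the closed two-sided ideal of E generated by Φ(f) equals T(I_f), where I_f is the closed two-sided ideal of B generated by the set of values {f(t) : t ∈ (0,1]}. -/
open scoped ZeroAtInfty

/-- The closed two-sided ideal of `A` generated by `S`. -/
def closedIdealGen {A : Type*} [NonUnitalRing A] [TopologicalSpace A] (S : Set A) : Set A :=
  ⋂₀ {I : Set A | IsClosedTwoSidedIdeal I ∧ S ⊆ I}

theorem isCTI_gen {A : Type*} [NonUnitalRing A] [TopologicalSpace A] (S : Set A) :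
    IsClosedTwoSidedIdeal (closedIdealGen S) := by
  refine ⟨isClosed_sInter fun I hI => hI.1.1, fun I hI => hI.1.2.1, ?_, ?_, ?_⟩
  · intro x hx y hy I hI
    exact hI.1.2.2.1 x (hx I hI) y (hy I hI)
  · intro x hx I hI
    exact hI.1.2.2.2.1 x (hx I hI)
  · intro a x hx
    exact ⟨fun I hI => (hI.1.2.2.2.2 a x (hx I hI)).1,
      fun I hI => (hI.1.2.2.2.2 a x (hx I hI)).2⟩

theorem subset_gen {A : Type*} [NonUnitalRing A] [TopologicalSpace A] (S : Set A) :
    S ⊆ closedIdealGen S := fun _ hx _ hI => hI.2 hx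

theorem gen_min {A : Type*} [NonUnitalRing A] [TopologicalSpace A] {S I : Set A}
    (hI : IsClosedTwoSidedIdeal I) (h : S ⊆ I) : closedIdealGen S ⊆ I :=
  fun _ hx => hx I ⟨hI, h⟩

theorem isCTI_zero {A : Type*} [NonUnitalRing A] [TopologicalSpace A] [T1Space A] :
    IsClosedTwoSidedIdeal ({0} : Set A) := by
  refine ⟨isClosed_singleton, rfl, ?_, ?_, ?_⟩ <;> simp

/-- The functional calculus package. -/
theorem cfc_pack {B : Type*} [NonUnitalCStarAlgebra B] (x : B) {ε : ℝ} (hε : 0 < ε) :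
    ∃ u : ℕ → B, (∀ n, u n = (star x * x) * u (n + 1)) ∧ (∀ n, ‖u n‖ ≤ (ε⁻¹) ^ n) ∧
      ‖x - x * u 0‖ ^ 2 ≤ ε := by
  set a := star x * x with ha
  have hsa : IsSelfAdjoint a := IsSelfAdjoint.star_mul_self x
  let m : ℝ → ℝ := fun l => max |l| ε
  have hm : ∀ l, 0 < m l := fun l => lt_max_of_lt_right hε
  have hmc : Continuous m := by fun_prop
  have hm1 : ∀ l, |l| ≤ m l := fun l => le_max_left _ _
  have hm2 : ∀ l, ε ≤ m l := fun l => le_max_right _ _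
  let w : ℝ → ℝ := fun l => (m l - ε) / m l
  have hwc : Continuous w := by
    refine Continuous.div (by fun_prop) hmc fun l => (hm l).ne'
  have hw0 : w 0 = 0 := by simp [w, m, hε.le]
  have hwle : ∀ l, |w l| ≤ 1 := by
    intro l
    have h0 : 0 ≤ w l := div_nonneg (by linarith [hm2 l]) (hm l).le
    rw [abs_of_nonneg h0]
    exact (div_le_one (hm l)).2 (by linarith)
  let v : ℝ → ℝ := fun l => l / (m l) ^ 2
  have hvc : Continuous v :=
    Continuous.div (by fun_prop) (by fun_prop) fun l => (pow_pos (hm l) 2).ne'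
  have hvle : ∀ l, |v l| ≤ ε⁻¹ := by
    intro l
    simp only [v]
    rw [abs_div, abs_of_pos (pow_pos (hm l) 2), div_le_iff₀ (pow_pos (hm l) 2),
      inv_mul_eq_div, le_div_iff₀ hε, sq]
    exact mul_le_mul (hm1 l) (hm2 l) hε.le (hm l).le
  let r : ℕ → ℝ → ℝ := fun n l => w l * v l ^ n
  have hrc : ∀ n, Continuous (r n) := fun n => hwc.mul (hvc.pow n)
  have hr0 : ∀ n, r n 0 = 0 := fun n => by simp [r, hw0]
  have hrec : ∀ n l, r n l = l * r (n + 1) l := by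
    intro n l
    have key : w l = w l * (l * v l) := by
      rcases le_total |l| ε with h | h
      · have : w l = 0 := by simp [w, m, max_eq_right h]
        simp [this]
      · have h2 : (m l) ^ 2 = l ^ 2 := by simp [m, max_eq_left h]
        have h3 : l * v l = 1 := by
          have := (pow_pos (hm l) 2).ne'
          simp only [v]
          rw [h2] at this ⊢
          field_simp
          exact div_self (fun h => this (by simp [h]))
        rw [h3, mul_one]
    simp only [r]
    rw [pow_succ]
    calc w l * v l ^ n = (w l * (l * v l)) * v l ^ n := by rw [← key]
      _ = _ := by ring
  refine ⟨fun n => cfcₙ (r n) a, ?_, ?_, ?_⟩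
  · intro n
    have h1 : cfcₙ (r n) a = cfcₙ (fun l => l * r (n + 1) l) a :=
      cfcₙ_congr fun l _ => hrec n l
    beta_reduce
    rw [h1, cfcₙ_mul (fun l => l) (r (n+1)) a continuous_id.continuousOn rfl
      (hrc _).continuousOn (hr0 _), cfcₙ_id' ℝ a]
  · intro n
    refine norm_cfcₙ_le fun l _ => ?_
    simp only [r, Real.norm_eq_abs]
    rw [abs_mul, abs_pow]
    calc |w l| * |v l| ^ n ≤ 1 * (ε⁻¹) ^ n :=
          mul_le_mul (hwle l) (pow_le_pow_left₀ (abs_nonneg _) (hvle l) n) (by positivity)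
            zero_le_one
      _ = _ := one_mul _
  · have hr : r 0 = w := by funext l; simp [r]
    beta_reduce
    rw [hr, sq, ← CStarRing.norm_star_mul_self]
    set W := cfcₙ w a with hW
    have hWs : star W = W := (IsSelfAdjoint.cfcₙ (f := w) (a := a)).star_eq
    have e1 : star (x - x * W) * (x - x * W) = (a - a * W) - W * (a - a * W) := by
      rw [star_sub, star_mul, hWs, ha]
      noncomm_ring
    have e2 : a - a * W = cfcₙ (fun l => l - l * w l) a := by
      rw [cfcₙ_sub (fun l => l) (fun l => l * w l) a continuous_id.continuousOn rfl
        (continuous_id.mul hwc).continuousOn (by simp),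
        cfcₙ_mul (fun l => l) w a continuous_id.continuousOn rfl hwc.continuousOn hw0,
        cfcₙ_id' ℝ a]
    have c3 : Continuous (fun l => l - l * w l) := continuous_id.sub (continuous_id.mul hwc)
    have e3 : (a - a * W) - W * (a - a * W)
        = cfcₙ (fun l => (l - l * w l) - w l * (l - l * w l)) a := by
      rw [cfcₙ_sub (fun l => l - l * w l) (fun l => w l * (l - l * w l)) a
        c3.continuousOn (by simp) (hwc.mul c3).continuousOn (by simp),
        cfcₙ_mul w (fun l => l - l * w l) a hwc.continuousOn hw0 c3.continuousOn (by simp), e2]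
    rw [e1, e3]
    refine norm_cfcₙ_le fun l _ => ?_
    have h1 : (l - l * w l) - w l * (l - l * w l) = l * (ε / m l) ^ 2 := by
      have := (hm l).ne'
      simp only [w]
      field_simp
      ring
    rw [h1, Real.norm_eq_abs, abs_mul, abs_pow, abs_of_pos (div_pos hε (hm l))]
    rw [div_pow, mul_div_assoc', div_le_iff₀ (pow_pos (hm l) 2)]
    have h4 : |l| * ε ≤ m l * m l := mul_le_mul (hm1 l) (hm2 l) hε.le (hm l).le
    nlinarith

/-- Membership in a closed ideal by iterated approximation. -/
theorem mem_of_approx {A : Type*} [NonUnitalNormedRing A] {K : Set A}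
    (hK : IsClosedTwoSidedIdeal K) {h k : A} (hk : k ∈ K) {δ ε C : ℝ} (hδ : 0 ≤ δ)
    (hε : 0 < ε) (hδε : δ < ε) (hd : ‖h - k‖ ≤ δ) (u : ℕ → A)
    (hu : ∀ n, u n = h * u (n + 1)) (hb : ∀ n, ‖u n‖ ≤ C * (ε⁻¹) ^ n) : u 0 ∈ K := by
  have claim : ∀ n m, ∃ k' ∈ K, ‖u m - k'‖ ≤ δ ^ n * ‖u (m + n)‖ := by
    intro n
    induction n with
    | zero => intro m; exact ⟨0, hK.2.1, by simp⟩
    | succ n ih =>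
      intro m
      obtain ⟨k', hk', hn⟩ := ih (m + 1)
      refine ⟨h * k' + k * (u (m+1) - k'), hK.2.2.1 _ (hK.2.2.2.2 _ _ hk').1 _
        (hK.2.2.2.2 _ _ hk).2, ?_⟩
      have : u m - (h * k' + k * (u (m+1) - k')) = (h - k) * (u (m+1) - k') := by
        rw [hu m]; noncomm_ring
      rw [this]
      calc ‖(h - k) * (u (m+1) - k')‖ ≤ ‖h - k‖ * ‖u (m+1) - k'‖ := norm_mul_le _ _
        _ ≤ δ * (δ ^ n * ‖u (m + 1 + n)‖) := mul_le_mul hd hn (norm_nonneg _) hδ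
        _ = _ := by rw [show m + 1 + n = m + (n + 1) by ring]; ring
  choose k' hk' hn using fun n => claim n 0
  have ht : Filter.Tendsto k' Filter.atTop (nhds (u 0)) := by
    rw [tendsto_iff_norm_sub_tendsto_zero]
    have hz : Filter.Tendsto (fun n : ℕ => C * (δ * ε⁻¹) ^ n) Filter.atTop (nhds (C * 0)) := by
      refine Filter.Tendsto.const_mul _ (tendsto_pow_atTop_nhds_zero_of_lt_one (by positivity) ?_)
      rw [← div_eq_mul_inv]; exact (div_lt_one hε).2 hδε
    rw [mul_zero] at hz
    refine squeeze_zero (fun _ => norm_nonneg _) (fun n => ?_) hz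
    rw [norm_sub_rev]
    calc _ ≤ δ ^ n * ‖u (0 + n)‖ := hn n
      _ ≤ δ ^ n * (C * (ε⁻¹) ^ n) := by
          rw [zero_add]; exact mul_le_mul_of_nonneg_left (hb n) (by positivity)
      _ = _ := by rw [mul_pow]; ring
  exact hK.1.mem_of_tendsto ht (Filter.Eventually.of_forall hk')

theorem c0_norm_le {X B : Type*} [TopologicalSpace X] [NormedAddCommGroup B] {f : C₀(X, B)} {C : ℝ}
    (hC : 0 ≤ C) (h : ∀ x, ‖f x‖ ≤ C) : ‖f‖ ≤ C := by
  rw [← ZeroAtInftyContinuousMap.norm_toBCF_eq_norm]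
  exact (BoundedContinuousFunction.norm_le hC).2 h

theorem c0_le_norm {X B : Type*} [TopologicalSpace X] [NormedAddCommGroup B] (f : C₀(X, B))
    (x : X) : ‖f x‖ ≤ ‖f‖ := by
  rw [← ZeroAtInftyContinuousMap.norm_toBCF_eq_norm]
  exact BoundedContinuousFunction.norm_coe_le_norm f.toBCF x

/-- Bump functions. -/
theorem exists_bump {X : Type*} [TopologicalSpace X] [T2Space X] [LocallyCompactSpace X]
    {N U : Set X} (hN : IsCompact N) (hU : IsOpen U) (h : N ⊆ U) :
    ∃ g : C₀(X, ℂ), (∀ s ∈ N, g s = 1) ∧ (∀ s ∉ U, g s = 0) ∧ ∀ s, ‖g s‖ ≤ 1 := by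
  obtain ⟨φ, h1, h0, hc, hI⟩ := exists_continuous_one_zero_of_isCompact hN hU.isClosed_compl
    (Set.disjoint_compl_right_iff_subset.2 h)
  have hcs : HasCompactSupport (fun s => (φ s : ℂ)) :=
    hc.comp_left (g := fun r : ℝ => (r : ℂ)) (by simp)
  refine ⟨⟨⟨fun s => (φ s : ℂ), by fun_prop⟩, hcs.is_zero_at_infty⟩, ?_, ?_, ?_⟩
  · intro s hs
    change (φ s : ℂ) = 1
    rw [h1 hs]; simp
  · intro s hs
    change (φ s : ℂ) = 0
    rw [h0 hs]; simp
  · intro s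
    change ‖(φ s : ℂ)‖ ≤ 1
    rw [Complex.norm_real, Real.norm_eq_abs, abs_of_nonneg (hI s).1]
    exact (hI s).2

/-- `f` lies in the ideal generated by elementary tensors with values in `I`. -/
theorem mem_gen_tensor {X B : Type*} [TopologicalSpace X] [NonUnitalCStarAlgebra B]
    (e : C₀(X, ℂ) → B → C₀(X, B)) (he : ∀ g x t, e g x t = g t • x) (I : Set B)
    (f : C₀(X, B)) (hf : Set.range f ⊆ I) {L : Set C₀(X, B)}
    (hL : IsClosedTwoSidedIdeal L) (h : ∀ g, ∀ x ∈ I, e g x ∈ L) : f ∈ L := by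
  rw [← hL.1.closure_eq, Metric.mem_closure_iff]
  intro η hη
  set δ := η / 2 with hδd
  have hδ : 0 < δ := by positivity
  have hfz := f.zero_at_infty'
  obtain ⟨C, hC, hCf⟩ : ∃ C : Set X, IsCompact C ∧ ∀ t ∉ C, ‖f t‖ < δ := by
    have := hfz (Metric.ball_mem_nhds 0 hδ)
    rw [Filter.mem_map, Filter.mem_cocompact] at this
    obtain ⟨C, hC, hs⟩ := this
    refine ⟨C, hC, fun t ht => ?_⟩
    simpa using hs ht
  obtain ⟨Y, hYs, hYf, hYc⟩ := (hC.image f.continuous).finite_cover_balls hδ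
  lift Y to Finset B using hYf
  let ρ : B → B → ℝ := fun y z => ‖z‖ * max 0 (δ - ‖z - y‖)
  let ρ0 : B → ℝ := fun z => max 0 (δ - ‖z‖)
  let σ : B → ℝ := fun z => ρ0 z + ∑ y ∈ Y, ρ y z
  have hρn : ∀ y z, 0 ≤ ρ y z := fun y z => by positivity
  have hρ0n : ∀ z, 0 ≤ ρ0 z := fun z => le_max_left _ _
  have hρc : ∀ y, Continuous (ρ y) := fun y => by fun_prop
  have hσc : Continuous σ := by fun_prop
  have hσsmall : ∀ z, ‖z‖ < δ → 0 < σ z := by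
    intro z hz
    have : 0 < ρ0 z := lt_max_of_lt_right (by linarith)
    exact add_pos_of_pos_of_nonneg this (Finset.sum_nonneg fun y _ => hρn y z)
  have hσf : ∀ t, 0 < σ (f t) := by
    intro t
    by_cases hz : ‖f t‖ < δ
    · exact hσsmall _ hz
    have htC : t ∈ C := by
      by_contra hh
      exact hz (hCf t hh)
    have := hYc (Set.mem_image_of_mem f htC)
    simp only [Set.mem_iUnion, Metric.mem_ball, exists_prop] at this
    obtain ⟨y, hy, hd⟩ := this
    rw [dist_eq_norm] at hd
    have h1 : 0 < ρ y (f t) :=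
      mul_pos (by linarith [not_lt.1 hz]) (lt_max_of_lt_right (by linarith))
    exact add_pos_of_nonneg_of_pos (hρ0n _)
      (Finset.sum_pos' (fun y _ => hρn y _) ⟨y, hy, h1⟩)
  let G : B → B → ℂ := fun y z => ((ρ y z / σ z : ℝ) : ℂ)
  have hGc : ∀ y z, 0 < σ z → ContinuousAt (G y) z := by
    intro y z hz
    exact Complex.continuous_ofReal.continuousAt.comp
      ((hρc y).continuousAt.div hσc.continuousAt hz.ne')
  have hG0 : ∀ y, G y 0 = 0 := fun y => by simp [G, ρ]
  let g : B → C₀(X, ℂ) := fun y => ⟨⟨fun t => G y (f t),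
    continuous_iff_continuousAt.2 fun t => ContinuousAt.comp' (hGc y _ (hσf t))
      f.continuous.continuousAt⟩, by
      have h0 : Filter.Tendsto (G y) (nhds 0) (nhds 0) := by
        have := hGc y 0 (hσsmall 0 (by simpa using hδ))
        rwa [ContinuousAt, hG0] at this
      exact h0.comp hfz⟩
  have hg : ∀ y t, g y t = ((ρ y (f t) / σ (f t) : ℝ) : ℂ) := fun _ _ => rfl
  have hsum : ∀ S : Finset B, (∀ y ∈ S, y ∈ I) → ∃ c ∈ L, ∀ t, c t = ∑ y ∈ S, g y t • y := by
    classical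
    intro S
    induction S using Finset.induction_on with
    | empty => intro _; exact ⟨0, hL.2.1, by simp⟩
    | insert y S hy ih =>
      intro hS
      obtain ⟨c, hc, hct⟩ := ih fun z hz => hS z (Finset.mem_insert_of_mem hz)
      refine ⟨e (g y) y + c, hL.2.2.1 _ (h _ _ (hS y (Finset.mem_insert_self _ _))) _ hc, ?_⟩
      intro t
      rw [Finset.sum_insert hy, ZeroAtInftyContinuousMap.add_apply, he, hct]
  obtain ⟨F, hF, hFt⟩ := hsum Y fun y hy => by
    obtain ⟨t, _, rfl⟩ := hYs hy
    exact hf ⟨t, rfl⟩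
  refine ⟨F, hF, ?_⟩
  rw [dist_eq_norm]
  refine lt_of_le_of_lt (c0_norm_le hδ.le fun t => ?_) (half_lt_self hη)
  rw [ZeroAtInftyContinuousMap.sub_apply, hFt]
  set z := f t with hz
  have hs := hσf t
  rw [← hz] at hs
  have key : z - ∑ y ∈ Y, g y t • y
      = (σ z)⁻¹ • (ρ0 z • z + ∑ y ∈ Y, ρ y z • (z - y)) := by
    have h1 : ∀ y, g y t • y = (σ z)⁻¹ • (ρ y z • y) := by
      intro y
      rw [hg, smul_smul, inv_mul_eq_div, Complex.coe_smul]
    simp only [h1, smul_sub, Finset.sum_sub_distrib]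
    rw [← Finset.smul_sum, ← Finset.sum_smul, ← add_sub_assoc, ← add_smul, smul_sub]
    change _ = (σ z)⁻¹ • (σ z • z) - _
    rw [inv_smul_smul₀ hs.ne']
  rw [key, norm_smul, norm_inv, Real.norm_eq_abs, abs_of_pos hs, inv_mul_le_iff₀ hs]
  have hb : ∀ y, ‖ρ y z • (z - y)‖ ≤ ρ y z * δ := by
    intro y
    rw [norm_smul, Real.norm_eq_abs, abs_of_nonneg (hρn y z)]
    rcases le_total ‖z - y‖ δ with h | h
    · exact mul_le_mul_of_nonneg_left h (hρn y z)
    · have : ρ y z = 0 := by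
        simp only [ρ]
        rw [max_eq_left (by linarith), mul_zero]
      simp [this]
  have hb0 : ‖ρ0 z • z‖ ≤ ρ0 z * δ := by
    rw [norm_smul, Real.norm_eq_abs, abs_of_nonneg (hρ0n z)]
    rcases le_total ‖z‖ δ with h | h
    · exact mul_le_mul_of_nonneg_left h (hρ0n z)
    · have : ρ0 z = 0 := max_eq_left (by linarith)
      simp [this]
  calc _ ≤ ‖ρ0 z • z‖ + ∑ y ∈ Y, ‖ρ y z • (z - y)‖ :=
        (norm_add_le _ _).trans (add_le_add_right (norm_sum_le _ _) _)
    _ ≤ ρ0 z * δ + ∑ y ∈ Y, ρ y z * δ := add_le_add hb0 (Finset.sum_le_sum fun y _ => hb y)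
    _ = σ z * δ := by rw [← Finset.sum_mul, ← add_mul]

/-- The local step. -/
theorem local_step {X B : Type*} [TopologicalSpace X] [T2Space X] [LocallyCompactSpace X]
    [NonUnitalCStarAlgebra B]
    (e : C₀(X, ℂ) → B → C₀(X, B)) (he : ∀ g x t, e g x t = g t • x)
    (f : C₀(X, B)) {K : Set C₀(X, B)} (hK : IsClosedTwoSidedIdeal K) (hfK : f ∈ K)
    (t : X) {ε : ℝ} (hε : 0 < ε) :
    ∃ p : B, ‖f t - f t * p‖ ^ 2 ≤ ε ∧ ∃ IC : Set C₀(X, ℂ), IsClosedTwoSidedIdeal IC ∧ IC ≠ {0} ∧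
      ∀ g ∈ IC, ∀ x ∈ closedIdealGen {p}, e g x ∈ K := by
  obtain ⟨u, hu, hub, hux⟩ := cfc_pack (f t) hε
  set a := star (f t) * f t with ha
  let U : Set X := {s | ‖a - star (f s) * f s‖ < ε / 2}
  have hU : IsOpen U := by
    refine isOpen_lt ?_ continuous_const
    have := f.continuous
    fun_prop
  have htU : t ∈ U := by simp [U, ha, hε]
  obtain ⟨N, hNc, htN, hNU⟩ := exists_compact_subset hU htU
  obtain ⟨g, hg1, hg0, hgb⟩ := exists_bump hNc hU hNU
  obtain ⟨g', hg'1, hg'0, -⟩ := exists_bump (isCompact_singleton (x := t)) isOpen_interior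
    (Set.singleton_subset_iff.2 htN)
  let IC : Set C₀(X, ℂ) := {q | ∀ s ∉ N, q s = 0}
  have heval : ∀ s, Continuous fun q : C₀(X, ℂ) => q s := by
    intro s
    refine LipschitzWith.continuous (K := 1) (LipschitzWith.of_dist_le_mul fun q q' => ?_)
    rw [dist_eq_norm, dist_eq_norm, ← ZeroAtInftyContinuousMap.sub_apply]
    simpa using c0_le_norm (q - q') s
  have hIC : IsClosedTwoSidedIdeal IC := by
    refine ⟨?_, by simp [IC], ?_, ?_, ?_⟩
    · simp only [IC, Set.ofPred_forall]
      exact isClosed_iInter fun s => isClosed_iInter fun _ =>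
        isClosed_eq (heval s) continuous_const
    · intro x hx y hy s hs; simp [hx s hs, hy s hs]
    · intro x hx s hs; simp [hx s hs]
    · intro b x hx; exact ⟨fun s hs => by simp [hx s hs], fun s hs => by simp [hx s hs]⟩
  -- the product of q ∈ IC with g
  have hgq : ∀ q ∈ IC, ∀ s, g s * q s = q s := by
    intro q hq s
    by_cases hs : s ∈ N
    · rw [hg1 s hs, one_mul]
    · rw [hq s hs, mul_zero]
  let gf : C₀(X, B) := ⟨⟨fun s => g s • star (f s), by
      have := f.continuous; have := g.continuous; fun_prop⟩, by
      have h1 := g.zero_at_infty'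
      have h2 := (f.zero_at_infty').star
      have := h1.smul h2
      simpa using this⟩
  have hk : gf * f ∈ K := (hK.2.2.2.2 gf f hfK).1
  have hd : ‖e g a - gf * f‖ ≤ ε / 2 := by
    refine c0_norm_le (by positivity) fun s => ?_
    have : (e g a - gf * f) s = g s • (a - star (f s) * f s) := by
      rw [ZeroAtInftyContinuousMap.sub_apply, ZeroAtInftyContinuousMap.mul_apply, he, smul_sub]
      change _ - (g s • star (f s)) * f s = _
      rw [smul_mul_assoc]
    rw [this, norm_smul]
    by_cases hs : s ∈ U
    · have h1 : ‖a - star (f s) * f s‖ < ε / 2 := hs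
      calc _ ≤ 1 * (ε / 2) := mul_le_mul (hgb s) h1.le (norm_nonneg _) zero_le_one
        _ = _ := one_mul _
    · rw [hg0 s hs]; simp; positivity
  have hen : ∀ q x, ‖e q x‖ ≤ ‖q‖ * ‖x‖ := by
    intro q x
    refine c0_norm_le (by positivity) fun s => ?_
    rw [he, norm_smul]
    exact mul_le_mul_of_nonneg_right (c0_le_norm q s) (norm_nonneg _)
  have hp : ∀ q ∈ IC, e q (u 0) ∈ K := by
    intro q hq
    refine mem_of_approx hK hk (by positivity : (0:ℝ) ≤ ε / 2) hε (half_lt_self hε) hd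
      (fun n => e q (u n)) (fun n => ?_) (C := ‖q‖) (fun n => ?_)
    · ext s
      rw [ZeroAtInftyContinuousMap.mul_apply, he, he, he, smul_mul_smul_comm, hgq q hq s, ← hu n]
    · exact (hen _ _).trans (mul_le_mul_of_nonneg_left (hub n) (norm_nonneg _))
  have hI : IsClosedTwoSidedIdeal {x : B | ∀ q ∈ IC, e q x ∈ K} := by
    refine ⟨?_, ?_, ?_, ?_, ?_⟩
    · simp only [Set.ofPred_forall]
      refine isClosed_iInter fun q => isClosed_iInter fun _ => hK.1.preimage ?_
      refine LipschitzWith.continuous (K := ‖q‖₊) (LipschitzWith.of_dist_le_mul fun x y => ?_)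
      have : e q x - e q y = e q (x - y) := by
        ext s; simp [he, smul_sub]
      rw [dist_eq_norm, dist_eq_norm, this]
      exact hen _ _
    · intro q _
      have : e q 0 = 0 := by ext s; simp [he]
      rw [this]; exact hK.2.1
    · intro x hx y hy q hq
      have : e q (x + y) = e q x + e q y := by ext s; simp [he]
      rw [this]; exact hK.2.2.1 _ (hx q hq) _ (hy q hq)
    · intro x hx q hq
      have : e q (-x) = - e q x := by ext s; simp [he]
      rw [this]; exact hK.2.2.2.1 _ (hx q hq)
    · intro b x hx
      refine ⟨fun q hq => ?_, fun q hq => ?_⟩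
      · have : e q (b * x) = e g b * e q x := by
          ext s
          rw [ZeroAtInftyContinuousMap.mul_apply, he, he, he, smul_mul_smul_comm, hgq q hq s]
        rw [this]; exact (hK.2.2.2.2 _ _ (hx q hq)).1
      · have : e q (x * b) = e q x * e g b := by
          ext s
          rw [ZeroAtInftyContinuousMap.mul_apply, he, he, he, smul_mul_smul_comm,
            mul_comm (q s), hgq q hq s]
        rw [this]; exact (hK.2.2.2.2 _ _ (hx q hq)).2
  refine ⟨u 0, hux, IC, hIC, ?_, ?_⟩
  · intro h
    have h1 : g' ∈ IC := fun s hs => hg'0 s fun h => hs (interior_subset h)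
    rw [h] at h1
    have h2 := hg'1 t rfl
    rw [Set.mem_singleton_iff.1 h1] at h2
    simp at h2
  · intro q hq x hx
    exact gen_min hI (Set.singleton_subset_iff.2 hp) hx q hq

/-- Let `B` and `E` be C*-algebras, and identify `C₀(0,1] ⊗ B` with the
cone `C₀((0,1], B)`.  Let `e g x` denote the element `t ↦ g(t) • x` of the cone, for
`g ∈ C₀((0,1], ℂ)` and `x ∈ B`; for closed two-sided ideals `I_C` of `C₀((0,1], ℂ)` and
`I_B` of `B`, the ideal `I_C ⊙ I_B` of the cone is the one generated by all `e g x` with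
`g ∈ I_C`, `x ∈ I_B`.  Let `T` map closed two-sided ideals of `B` to closed two-sided
ideals of `E`, commuting with ideals generated by unions of families of ideals.  Suppose
`Φ : C₀((0,1], B) → E` is a *-homomorphism such that for all nonzero closed two-sided
ideals `I_C`, `I_B`, the closed ideal of `E` generated by `Φ(I_C ⊙ I_B)` equals `T I_B`.
Then for every `f` in the cone, the closed ideal of `E` generated by `Φ f` equals
`T I_f`, where `I_f` is the closed two-sided ideal of `B` generated by the values of `f`. -/
theorem stmt8 {B E : Type*} [NonUnitalCStarAlgebra B] [NonUnitalCStarAlgebra E]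
    (e : C₀(↥(Set.Ioc (0 : ℝ) 1), ℂ) → B → C₀(↥(Set.Ioc (0 : ℝ) 1), B))
    (he : ∀ (g : C₀(↥(Set.Ioc (0 : ℝ) 1), ℂ)) (x : B) (t : ↥(Set.Ioc (0 : ℝ) 1)),
      e g x t = g t • x)
    (T : Set B → Set E)
    (hT1 : ∀ I : Set B, IsClosedTwoSidedIdeal I → IsClosedTwoSidedIdeal (T I))
    (hT2 : ∀ 𝒮 : Set (Set B), (∀ I ∈ 𝒮, IsClosedTwoSidedIdeal I) →
      T (closedIdealGen (⋃₀ 𝒮)) = closedIdealGen (⋃ I ∈ 𝒮, T I))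
    (Φ : C₀(↥(Set.Ioc (0 : ℝ) 1), B) →⋆ₙₐ[ℂ] E)
    (hΦ : ∀ (IC : Set (C₀(↥(Set.Ioc (0 : ℝ) 1), ℂ))) (IB : Set B),
      IsClosedTwoSidedIdeal IC → IC ≠ {0} → IsClosedTwoSidedIdeal IB → IB ≠ {0} →
      closedIdealGen
          (Φ '' closedIdealGen {c : C₀(↥(Set.Ioc (0 : ℝ) 1), B) |
            ∃ g ∈ IC, ∃ x ∈ IB, c = e g x})
        = T IB)
    (f : C₀(↥(Set.Ioc (0 : ℝ) 1), B)) :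
    closedIdealGen {Φ f} = T (closedIdealGen (Set.range ⇑f)) := by
  have hX : LocallyCompactSpace ↥(Set.Ioc (0 : ℝ) 1) :=
    isLocallyClosed_Ioc.locallyCompactSpace
  have hΦc : Continuous Φ := by
    refine LipschitzWith.continuous (K := 1) (LipschitzWith.of_dist_le_mul fun x y => ?_)
    rw [dist_eq_norm, dist_eq_norm, ← map_sub]
    simpa using NonUnitalStarAlgHom.norm_apply_le Φ (x - y)
  have hpre : ∀ J : Set E, IsClosedTwoSidedIdeal J → IsClosedTwoSidedIdeal (Φ ⁻¹' J) := by
    intro J hJ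
    refine ⟨hJ.1.preimage hΦc, ?_, ?_, ?_, ?_⟩
    · rw [Set.mem_preimage, map_zero]; exact hJ.2.1
    · intro x hx y hy
      rw [Set.mem_preimage, map_add]; exact hJ.2.2.1 _ hx _ hy
    · intro x hx
      rw [Set.mem_preimage, map_neg]; exact hJ.2.2.2.1 _ hx
    · intro b x hx
      rw [Set.mem_preimage, Set.mem_preimage, map_mul, map_mul]
      exact hJ.2.2.2.2 _ _ hx
  have hT0 : ∀ J : Set E, IsClosedTwoSidedIdeal J → T {0} ⊆ J := by
    intro J hJ
    have h := hT2 ∅ (by simp)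
    have h0 : closedIdealGen (⋃₀ (∅ : Set (Set B))) = {0} :=
      Set.Subset.antisymm (gen_min isCTI_zero (by simp))
        (Set.singleton_subset_iff.2 (isCTI_gen _).2.1)
    rw [h0] at h
    rw [h]
    exact gen_min hJ (by simp)
  have hmono : ∀ I I' : Set B, IsClosedTwoSidedIdeal I → IsClosedTwoSidedIdeal I' → I ⊆ I' →
      T I ⊆ T I' := by
    intro I I' hI hI' hII
    have h := hT2 {I, I'} (by
      intro J hJ
      rcases hJ with rfl | rfl <;> assumption)
    have h0 : closedIdealGen (⋃₀ {I, I'}) = I' := by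
      refine Set.Subset.antisymm (gen_min hI' ?_) ?_
      · simp [hII]
      · exact (Set.subset_sUnion_of_mem (by simp)).trans (subset_gen _)
    rw [h0] at h
    rw [h]
    refine Set.Subset.trans ?_ (subset_gen _)
    exact Set.subset_biUnion_of_mem (u := fun I => T I) (by simp)
  have hIf := isCTI_gen (Set.range ⇑f)
  apply Set.Subset.antisymm
  · refine gen_min (hT1 _ hIf) (Set.singleton_subset_iff.2 ?_)
    by_cases hz : closedIdealGen (Set.range ⇑f) = {0}
    · have : f = 0 := by
        ext t
        have : f t ∈ closedIdealGen (Set.range ⇑f) := subset_gen _ ⟨t, rfl⟩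
        rw [hz] at this
        exact this
      rw [this, map_zero]
      exact (hT1 _ (isCTI_gen _)).2.1
    · have hne : (Set.univ : Set C₀(↥(Set.Ioc (0 : ℝ) 1), ℂ)) ≠ {0} := by
        intro h
        obtain ⟨g, hg, -⟩ := exists_bump (X := ↥(Set.Ioc (0 : ℝ) 1))
          (isCompact_singleton (x := ⟨1, by simp⟩)) isOpen_univ (Set.subset_univ _)
        have h1 : g ∈ (Set.univ : Set C₀(↥(Set.Ioc (0 : ℝ) 1), ℂ)) := trivial
        rw [h] at h1
        have h2 := hg _ rfl
        rw [Set.mem_singleton_iff.1 h1] at h2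
        simp at h2
      rw [← hΦ Set.univ _ ⟨isClosed_univ, by simp, by simp, by simp, by simp⟩ hne hIf hz]
      refine subset_gen _ ⟨f, ?_, rfl⟩
      exact mem_gen_tensor e he _ f (subset_gen _) (isCTI_gen _)
        fun g x hx => subset_gen _ ⟨g, trivial, x, hx, rfl⟩
  · set J := closedIdealGen {Φ f} with hJd
    have hJ : IsClosedTwoSidedIdeal J := isCTI_gen _
    have hfK : f ∈ Φ ⁻¹' J := subset_gen _ rfl
    let 𝒮 : Set (Set B) := {I | IsClosedTwoSidedIdeal I ∧ T I ⊆ J}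
    have hTS : T (closedIdealGen (⋃₀ 𝒮)) ⊆ J := by
      rw [hT2 𝒮 fun I hI => hI.1]
      exact gen_min hJ (Set.iUnion₂_subset fun I hI => hI.2)
    refine (hmono _ _ hIf (isCTI_gen _) (gen_min (isCTI_gen _) ?_)).trans hTS
    rintro _ ⟨t, rfl⟩
    rw [← (isCTI_gen (⋃₀ 𝒮)).1.closure_eq, Metric.mem_closure_iff]
    intro η hη
    obtain ⟨p, hp, IC, hIC, hIC0, hmem⟩ := local_step e he f (hpre J hJ) hfK t
      (ε := (η / 2) ^ 2) (by positivity)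
    refine ⟨f t * p, ?_, ?_⟩
    · refine ((isCTI_gen (⋃₀ 𝒮)).2.2.2.2 _ _ (subset_gen _ ?_)).1
      refine ⟨closedIdealGen {p}, ⟨isCTI_gen _, ?_⟩, subset_gen _ rfl⟩
      by_cases hz : closedIdealGen {p} = {0}
      · rw [hz]; exact hT0 J hJ
      · rw [← hΦ IC _ hIC hIC0 (isCTI_gen _) hz]
        refine gen_min hJ (Set.image_subset_iff.2 (gen_min (hpre J hJ) ?_))
        rintro _ ⟨g, hg, x, hx, rfl⟩
        exact hmem g hg x hx
    · rw [dist_eq_norm]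
      have := abs_le_of_sq_le_sq hp (by positivity : (0:ℝ) ≤ η / 2)
      have h2 := le_abs_self ‖f t - f t * p‖
      linarith
end
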